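/- (Tweedie's formula, one-dimensional.) Let X be an integrable real random variable on a probability space, let Z be a standard Gaussian random variable independent of X, let a ≠ 0 and σ > 0 be reals, and set Y = a·X + σ·Z. Then Y admits a positive, continuously differentiable density p_Y with respect to Lebesgue measure, and the conditional expectation of X given the σ-algebra generated by Y satisfies E[X | Y] = (Y + σ²·(p_Y'(Y)/p_Y(Y))) / a almost surely; that is, E[X | Y] = (Y + σ²·(log p_Y)'(Y)) / a almost surely. -/

import Mathlib

open MeasureTheory ProbabilityTheory

section GaussianPDF

open Real
open scoped NNReal

lemma gaussianPDFReal_le (m : ℝ) (v : ℝ≥0) (y : ℝ) :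
    gaussianPDFReal m v y ≤ (√(2 * π * v))⁻¹ := by
  refine mul_le_of_le_one_right (by positivity) (exp_le_one_iff.2 ?_)
  exact div_nonpos_of_nonpos_of_nonneg (neg_nonpos.2 (sq_nonneg _)) (by positivity)

lemma abs_sub_mul_gaussianPDFReal_le (m : ℝ) {v : ℝ≥0} (hv : v ≠ 0) (y : ℝ) :
    |m - y| * gaussianPDFReal m v y ≤ (√(2 * π * v))⁻¹ * (v + 1) := by
  have hv0 : (0 : ℝ) < v := NNReal.coe_pos.2 hv.bot_lt
  have h : |m - y| ≤ (v + 1) * exp ((y - m) ^ 2 / (2 * v)) := by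
    have h1 := add_one_le_exp ((y - m) ^ 2 / (2 * v))
    have h2 : |m - y| ≤ (v + 1) * ((y - m) ^ 2 / (2 * v) + 1) := by
      have h3 : ((v : ℝ) + 1) * ((y - m) ^ 2 / (2 * v) + 1)
          = (y - m) ^ 2 / 2 + (y - m) ^ 2 / (2 * v) + v + 1 := by
        field_simp
        ring
      have h4 : 0 ≤ (y - m) ^ 2 / (2 * (v : ℝ)) := by positivity
      have h5 : (y - m) ^ 2 = |m - y| ^ 2 := by rw [sq_abs]; ring
      nlinarith [sq_nonneg (|m - y| - 1)]
    exact h2.trans (by gcongr)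
  have he : exp (-(y - m) ^ 2 / (2 * v)) = (exp ((y - m) ^ 2 / (2 * v)))⁻¹ := by
    rw [← exp_neg, neg_div]
  rw [gaussianPDFReal_def]
  simp only
  rw [he, mul_left_comm]
  gcongr
  rwa [← div_eq_mul_inv, div_le_iff₀ (exp_pos _)]

lemma hasDerivAt_gaussianPDFReal (m : ℝ) (v : ℝ≥0) (y : ℝ) :
    HasDerivAt (gaussianPDFReal m v) ((m - y) / v * gaussianPDFReal m v y) y := by
  rw [gaussianPDFReal_def]
  have h : HasDerivAt (fun y : ℝ ↦ -(y - m) ^ 2 / (2 * v)) ((m - y) / v) y := by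
    refine ((((hasDerivAt_id y).sub_const m).pow 2).neg.div_const (2 * (v : ℝ))).congr_deriv ?_
    simp only [id, Nat.cast_ofNat, Nat.add_one_sub_one, pow_one, mul_one]
    rw [← mul_neg, neg_sub, mul_div_mul_left _ _ two_ne_zero]
  exact (h.exp.const_mul (√(2 * π * v))⁻¹).congr_deriv (by ring)

lemma measurable_gaussianPDFReal_left (v : ℝ≥0) (y : ℝ) :
    Measurable fun m ↦ gaussianPDFReal m v y := by
  unfold gaussianPDFReal
  fun_prop

lemma continuous_gaussianPDFReal (m : ℝ) (v : ℝ≥0) : Continuous (gaussianPDFReal m v) := by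
  unfold gaussianPDFReal
  fun_prop

lemma measurable_gaussianPDF_prod (v : ℝ≥0) :
    Measurable fun z : ℝ × ℝ ↦ gaussianPDF z.1 v z.2 := by
  unfold gaussianPDF gaussianPDFReal
  fun_prop

/-- The density of the convolution of `ν` with the centred Gaussian of variance `v`. -/
noncomputable def gaussianConvPDF (ν : Measure ℝ) (v : ℝ≥0) (y : ℝ) : ℝ :=
  ∫ u, gaussianPDFReal u v y ∂ν

variable {ν : Measure ℝ} [IsFiniteMeasure ν] {v : ℝ≥0}

lemma integrable_gaussianPDFReal_left (y : ℝ) :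
    Integrable (fun u ↦ gaussianPDFReal u v y) ν := by
  refine Integrable.of_bound (measurable_gaussianPDFReal_left v y).aestronglyMeasurable
    (√(2 * π * v))⁻¹ (.of_forall fun u ↦ ?_)
  rw [norm_of_nonneg (gaussianPDFReal_nonneg _ _ _)]
  exact gaussianPDFReal_le u v y

lemma norm_sub_div_mul_gaussianPDFReal_le (hv : v ≠ 0) (u y : ℝ) :
    ‖(u - y) / v * gaussianPDFReal u v y‖ ≤ (√(2 * π * v))⁻¹ * (v + 1) / v := by
  rw [norm_mul, norm_div, norm_of_nonneg (gaussianPDFReal_nonneg _ _ _), norm_eq_abs,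
    norm_of_nonneg (NNReal.coe_nonneg v), div_mul_eq_mul_div]
  exact div_le_div_of_nonneg_right (abs_sub_mul_gaussianPDFReal_le u hv y) v.coe_nonneg

lemma integrable_sub_div_mul_gaussianPDFReal (hv : v ≠ 0) (y : ℝ) :
    Integrable (fun u ↦ (u - y) / v * gaussianPDFReal u v y) ν := by
  have := measurable_gaussianPDFReal_left v y
  exact Integrable.of_bound (by fun_prop) _
    (.of_forall fun u ↦ norm_sub_div_mul_gaussianPDFReal_le hv u y)

lemma hasDerivAt_gaussianConvPDF (hv : v ≠ 0) (y : ℝ) :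
    HasDerivAt (gaussianConvPDF ν v) (∫ u, (u - y) / v * gaussianPDFReal u v y ∂ν) y :=
  (hasDerivAt_integral_of_dominated_loc_of_deriv_le (F := fun y u ↦ gaussianPDFReal u v y)
    (F' := fun y u ↦ (u - y) / v * gaussianPDFReal u v y) Filter.univ_mem
    (.of_forall fun y ↦ (measurable_gaussianPDFReal_left v y).aestronglyMeasurable)
    (integrable_gaussianPDFReal_left y)
    (integrable_sub_div_mul_gaussianPDFReal hv y).aestronglyMeasurable
    (.of_forall fun u y _ ↦ norm_sub_div_mul_gaussianPDFReal_le hv u y)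
    (integrable_const _)
    (.of_forall fun u y _ ↦ hasDerivAt_gaussianPDFReal u v y)).2

lemma contDiff_gaussianConvPDF (hv : v ≠ 0) : ContDiff ℝ 1 (gaussianConvPDF ν v) := by
  refine contDiff_one_iff_deriv.2
    ⟨fun y ↦ (hasDerivAt_gaussianConvPDF hv y).differentiableAt, ?_⟩
  rw [funext fun y ↦ (hasDerivAt_gaussianConvPDF (ν := ν) hv y).deriv]
  refine continuous_of_dominated
    (fun y ↦ (integrable_sub_div_mul_gaussianPDFReal hv y).aestronglyMeasurable)
    (fun y ↦ .of_forall fun u ↦ norm_sub_div_mul_gaussianPDFReal_le hv u y)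
    (integrable_const _) (.of_forall fun u ↦ ?_)
  have := continuous_gaussianPDFReal u v
  fun_prop

lemma gaussianConvPDF_pos [NeZero ν] (hv : v ≠ 0) (y : ℝ) : 0 < gaussianConvPDF ν v y := by
  refine (integral_pos_iff_support_of_nonneg (fun u ↦ gaussianPDFReal_nonneg u v y)
    (integrable_gaussianPDFReal_left y)).2 ?_
  have : (Function.support fun u ↦ gaussianPDFReal u v y) = Set.univ :=
    Set.eq_univ_of_forall fun u ↦ (gaussianPDFReal_pos u v y hv).ne'
  rw [this, Measure.measure_univ_pos]
  exact NeZero.ne ν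

/-- The first moment of `u ↦ gaussianPDFReal u v y` in terms of the score of the convolution. -/
lemma integral_gaussianPDFReal_mul_id [NeZero ν] (hv : v ≠ 0) (y : ℝ) :
    ∫ u, gaussianPDFReal u v y * u ∂ν = gaussianConvPDF ν v y *
      (y + v * (deriv (gaussianConvPDF ν v) y / gaussianConvPDF ν v y)) := by
  have hp := (gaussianConvPDF_pos (ν := ν) hv y).ne'
  have hv0 : (v : ℝ) ≠ 0 := NNReal.coe_ne_zero.2 hv
  have h : ∀ u, gaussianPDFReal u v y * u
      = y * gaussianPDFReal u v y + v * ((u - y) / v * gaussianPDFReal u v y) := fun u ↦ by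
    field_simp
    ring
  simp_rw [h]
  rw [integral_add ((integrable_gaussianPDFReal_left y).const_mul y)
      ((integrable_sub_div_mul_gaussianPDFReal hv y).const_mul _),
    integral_const_mul, integral_const_mul, (hasDerivAt_gaussianConvPDF hv y).deriv]
  rw [mul_add, mul_left_comm _ (v : ℝ), mul_div_cancel₀ _ hp, gaussianConvPDF, mul_comm y]

end GaussianPDF

section Tweedie

open scoped NNReal

variable {Ω : Type*} [MeasurableSpace Ω] {P : Measure Ω} [IsProbabilityMeasure P]
  {U G : Ω → ℝ} {v : ℝ≥0}

lemma map_prodMk_add_gaussianReal (hU : Measurable U) (hG : Measurable G)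
    (hGlaw : P.map G = gaussianReal 0 v) (hindep : IndepFun U G P) (hv : v ≠ 0) :
    P.map (fun ω ↦ (U ω, U ω + G ω)) =
      ((P.map U).prod volume).withDensity fun z ↦ gaussianPDF z.1 v z.2 := by
  have := Measure.isProbabilityMeasure_map hU.aemeasurable (μ := P)
  have hshear : Measurable fun z : ℝ × ℝ ↦ (z.1, z.1 + z.2) := by fun_prop
  have hmap : P.map (fun ω ↦ (U ω, U ω + G ω)) =
      ((P.map U).prod (gaussianReal 0 v)).map fun z ↦ (z.1, z.1 + z.2) := by
    rw [← hGlaw, ← hindep.map_prod_eq_prod_map_map hU.aemeasurable hG.aemeasurable,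
      Measure.map_map hshear (hU.prodMk hG)]
    rfl
  ext s hs
  rw [hmap, Measure.map_apply hshear hs, Measure.prod_apply (hshear hs), withDensity_apply _ hs,
    ← lintegral_indicator hs,
    lintegral_prod _ ((measurable_gaussianPDF_prod v).indicator hs).aemeasurable]
  refine lintegral_congr fun u ↦ ?_
  have hsu : MeasurableSet (Prod.mk u ⁻¹' s) := measurable_prodMk_left hs
  have hpre : (Prod.mk u ⁻¹' ((fun z : ℝ × ℝ ↦ (z.1, z.1 + z.2)) ⁻¹' s)) =
    (u + ·) ⁻¹' (Prod.mk u ⁻¹' s) := rfl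
  rw [hpre, ← Measure.map_apply (by fun_prop) hsu, gaussianReal_map_const_add, zero_add,
    gaussianReal_apply u hv, ← lintegral_indicator hsu]
  rfl

lemma map_add_gaussianReal (hU : Measurable U) (hG : Measurable G)
    (hGlaw : P.map G = gaussianReal 0 v) (hindep : IndepFun U G P) (hv : v ≠ 0) :
    P.map (fun ω ↦ U ω + G ω) =
      volume.withDensity fun y ↦ ENNReal.ofReal (gaussianConvPDF (P.map U) v y) := by
  have := Measure.isProbabilityMeasure_map hU.aemeasurable (μ := P)
  have hsnd : P.map (fun ω ↦ U ω + G ω) = (P.map fun ω ↦ (U ω, U ω + G ω)).map Prod.snd := by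
    rw [Measure.map_map measurable_snd (by fun_prop)]
    rfl
  rw [hsnd, map_prodMk_add_gaussianReal hU hG hGlaw hindep hv]
  ext s hs
  rw [Measure.map_apply measurable_snd hs, withDensity_apply _ (measurable_snd hs),
    withDensity_apply _ hs, ← Set.univ_prod, ← Measure.prod_restrict,
    lintegral_prod_symm _ (measurable_gaussianPDF_prod v).aemeasurable, Measure.restrict_univ]
  refine lintegral_congr fun y ↦ ?_
  rw [gaussianConvPDF, ofReal_integral_eq_lintegral_ofReal (integrable_gaussianPDFReal_left y)
    (.of_forall fun u ↦ gaussianPDFReal_nonneg u v y)]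
  rfl

/-- Tweedie's formula for additive Gaussian noise of variance `v`. -/
lemma condExp_add_gaussianReal (hU : Measurable U) (hG : Measurable G)
    (hUint : Integrable U P) (hGlaw : P.map G = gaussianReal 0 v)
    (hindep : IndepFun U G P) (hv : v ≠ 0) {Y : Ω → ℝ} (hY : Y = fun ω ↦ U ω + G ω) :
    P[U | MeasurableSpace.comap Y Real.measurableSpace] =ᵐ[P] fun ω ↦
      Y ω + v * (deriv (gaussianConvPDF (P.map U) v) (Y ω) /
        gaussianConvPDF (P.map U) v (Y ω)) := by
  have := Measure.isProbabilityMeasure_map hU.aemeasurable (μ := P)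
  set ν := P.map U with hν
  set g : ℝ → ℝ := fun y ↦ y + v * (deriv (gaussianConvPDF ν v) y / gaussianConvPDF ν v y)
    with hg
  have hYm : Measurable Y := hY ▸ hU.add hG
  have hUY : Measurable fun ω ↦ (U ω, Y ω) := hU.prodMk hYm
  have hjoint : P.map (fun ω ↦ (U ω, Y ω)) =
      (ν.prod volume).withDensity fun z ↦ gaussianPDF z.1 v z.2 := by
    rw [hY]; exact map_prodMk_add_gaussianReal hU hG hGlaw hindep hv
  have hlaw : P.map Y =
      volume.withDensity fun y ↦ ENNReal.ofReal (gaussianConvPDF ν v y) := by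
    rw [hY]; exact map_add_gaussianReal hU hG hGlaw hindep hv
  have hpm : Measurable (gaussianConvPDF ν v) :=
    (contDiff_gaussianConvPDF hv).continuous.measurable
  have hpofReal : Measurable fun y ↦ ENNReal.ofReal (gaussianConvPDF ν v y) :=
    hpm.ennreal_ofReal
  have hgm : Measurable g := by
    have := measurable_deriv (gaussianConvPDF ν v)
    fun_prop
  have hpdf := measurable_gaussianPDF_prod v
  have hprod : Integrable (fun z : ℝ × ℝ ↦ gaussianPDFReal z.1 v z.2 * z.1)
      (ν.prod volume) := by
    have h : Integrable Prod.fst (P.map fun ω ↦ (U ω, Y ω)) :=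
      (integrable_map_measure measurable_fst.aestronglyMeasurable hUY.aemeasurable).2 hUint
    rw [hjoint, integrable_withDensity_iff_integrable_smul' hpdf
      (.of_forall fun _ ↦ gaussianPDF_lt_top)] at h
    simpa only [toReal_gaussianPDF, smul_eq_mul] using h
  have hpnn (y : ℝ) : (ENNReal.ofReal (gaussianConvPDF ν v y)).toReal = gaussianConvPDF ν v y :=
    ENNReal.toReal_ofReal (gaussianConvPDF_pos hv y).le
  have hgint : Integrable (fun ω ↦ g (Y ω)) P := by
    refine (integrable_map_measure hgm.aestronglyMeasurable hYm.aemeasurable).1 ?_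
    rw [hlaw, integrable_withDensity_iff_integrable_smul' hpofReal
      (.of_forall fun _ ↦ ENNReal.ofReal_lt_top)]
    simpa only [hpnn, smul_eq_mul, hg, integral_gaussianPDFReal_mul_id hv]
      using hprod.integral_prod_right
  symm
  refine ae_eq_condExp_of_forall_setIntegral_eq hYm.comap_le hUint
    (fun s _ _ ↦ hgint.integrableOn) ?_
    (hgm.comp (comap_measurable Y)).aestronglyMeasurable
  rintro _ ⟨t, ht, rfl⟩ -
  calc ∫ ω in Y ⁻¹' t, g (Y ω) ∂P
      = ∫ y in t, g y ∂(P.map Y) :=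
        (setIntegral_map ht hgm.aestronglyMeasurable hYm.aemeasurable).symm
    _ = ∫ y in t, ∫ u, gaussianPDFReal u v y * u ∂ν := by
        rw [hlaw, restrict_withDensity ht, integral_withDensity_eq_integral_toReal_smul hpofReal
          (.of_forall fun _ ↦ ENNReal.ofReal_lt_top)]
        simp only [hpnn, smul_eq_mul, hg, integral_gaussianPDFReal_mul_id hv]
    _ = ∫ z in Set.univ ×ˢ t, gaussianPDFReal z.1 v z.2 * z.1 ∂(ν.prod volume) := by
        have h := hprod.integrableOn (s := Set.univ ×ˢ t)
        rw [IntegrableOn, ← Measure.prod_restrict] at h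
        rw [← Measure.prod_restrict, integral_prod_symm _ h, Measure.restrict_univ]
    _ = ∫ z in Set.univ ×ˢ t, z.1 ∂(P.map fun ω ↦ (U ω, Y ω)) := by
        rw [hjoint, restrict_withDensity (MeasurableSet.univ.prod ht),
          integral_withDensity_eq_integral_toReal_smul hpdf
            (.of_forall fun _ ↦ gaussianPDF_lt_top)]
        simp only [toReal_gaussianPDF, smul_eq_mul]
    _ = ∫ ω in Y ⁻¹' t, U ω ∂P := by
        rw [setIntegral_map (MeasurableSet.univ.prod ht) measurable_fst.aestronglyMeasurable
          hUY.aemeasurable, Set.mk_preimage_prod, Set.preimage_univ, Set.univ_inter]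

end Tweedie

/-- **Tweedie's formula, one-dimensional.** Let `X` be an integrable real
random variable, `Z` a standard Gaussian independent of `X`, `a ≠ 0`, `σ > 0`, and
`Y = a • X + σ • Z`. Then `Y` admits a positive, continuously differentiable density `pY`
with respect to Lebesgue measure, and
`E[X | Y] = (Y + σ² * (pY' Y / pY Y)) / a` almost surely, i.e.
`E[X | Y] = (Y + σ² * (log pY)'(Y)) / a`. -/
theorem tweedie_formula_one_dim {Ω : Type*} [MeasurableSpace Ω]
    (P : Measure Ω) [IsProbabilityMeasure P]
    (X Z : Ω → ℝ) (hX : Measurable X) (hZ : Measurable Z)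
    (hXint : Integrable X P)
    (hZlaw : P.map Z = gaussianReal 0 1)
    (hindep : IndepFun X Z P)
    (a σ : ℝ) (ha : a ≠ 0) (hσ : 0 < σ)
    (Y : Ω → ℝ) (hY : Y = fun ω => a * X ω + σ * Z ω) :
    ∃ pY : ℝ → ℝ, (∀ y, 0 < pY y) ∧ ContDiff ℝ 1 pY ∧
      P.map Y = volume.withDensity (fun y => ENNReal.ofReal (pY y)) ∧
      P[X | MeasurableSpace.comap Y Real.measurableSpace]
        =ᵐ[P] fun ω => (Y ω + σ ^ 2 * (deriv pY (Y ω) / pY (Y ω))) / a := by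
  have hv : Real.toNNReal (σ ^ 2) ≠ 0 := (Real.toNNReal_pos.2 (by positivity)).ne'
  have hU : Measurable fun ω ↦ a * X ω := hX.const_mul a
  have hG : Measurable fun ω ↦ σ * Z ω := hZ.const_mul σ
  have hGlaw : P.map (fun ω ↦ σ * Z ω) = gaussianReal 0 (Real.toNNReal (σ ^ 2)) := by
    have h := (gaussianReal_const_mul ⟨hZ.aemeasurable, hZlaw⟩ σ).map_eq
    rw [h, mul_zero, mul_one]
    congr 1
    exact NNReal.eq (Real.coe_toNNReal _ (sq_nonneg σ)).symm
  have hUG : IndepFun (fun ω ↦ a * X ω) (fun ω ↦ σ * Z ω) P :=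
    hindep.comp (measurable_const_mul a) (measurable_const_mul σ)
  have := Measure.isProbabilityMeasure_map hU.aemeasurable (μ := P)
  refine ⟨gaussianConvPDF (P.map fun ω ↦ a * X ω) (Real.toNNReal (σ ^ 2)),
    gaussianConvPDF_pos hv, contDiff_gaussianConvPDF hv, ?_, ?_⟩
  · rw [hY]
    exact map_add_gaussianReal hU hG hGlaw hUG hv
  · have hcond := condExp_add_gaussianReal hU hG (hXint.const_mul a) hGlaw hUG hv hY
    have hsmul := condExp_smul (μ := P) a X (MeasurableSpace.comap Y Real.measurableSpace)
    filter_upwards [hcond, hsmul] with ω h1 h2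
    rw [eq_div_iff ha, mul_comm]
    rw [Real.coe_toNNReal _ (sq_nonneg σ)] at h1
    exact h2.symm.trans h1
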